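/- arXiv:1901.04458 — 4 statements merged into one kernel-verified Lean document; each statement's English description precedes it below -/
import Mathlib

section
/- Let α ≥ 0 and p ∈ (0,∞). Then there exists a constant C(p,α) such that for every even f ∈ E_{1,1} with ∫_ℝ |f(t)|^p |t|^α dt < ∞, one has sup_{t∈ℝ}|f(t)| ≤ C(p,α)·(∫_ℝ |f(t)|^p |t|^α dt)^{1/p}. -/
open MeasureTheory Filter Topology ENNReal

noncomputable section

/-- `f : ℂ → ℂ` is an entire function of exponential type `σ`. -/
def SphericalType1 (σ : ℝ) (f : ℂ → ℂ) : Prop :=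
  Differentiable ℂ f ∧ ∀ ε : ℝ, 0 < ε → ∃ C : ℝ, ∀ z, ‖f z‖ ≤ C * Real.exp (σ * (1 + ε) * ‖z‖)


lemma core {α : ℝ} (hα : 0 ≤ α) {p : ℝ} (hp : 0 < p) {f : ℂ → ℂ} (hf : Differentiable ℂ f)
    {L : ℝ} (hL : 0 < L) (x0 : ℝ) (hb : ∀ w ∈ Metric.ball (x0 : ℂ) 1, ‖f w‖ ≤ L)
    (hJ : (∫⁻ t : ℝ, (‖f t‖₊ : ℝ≥0∞) ^ p * ENNReal.ofReal (|t| ^ α)) < ⊤) :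
    ‖f x0‖ ^ (p + (1 + α)) ≤ 2 ^ p * 12 ^ (1 + α) *
      (∫⁻ t : ℝ, (‖f t‖₊ : ℝ≥0∞) ^ p * ENNReal.ofReal (|t| ^ α)).toReal * L ^ (1 + α) := by
  set J := ∫⁻ t : ℝ, (‖f t‖₊ : ℝ≥0∞) ^ p * ENNReal.ofReal (|t| ^ α) with hJdef
  set B := ‖f x0‖ with hB
  rcases (norm_nonneg (f x0)).eq_or_lt with h0 | h0
  · rw [hB, ← h0, Real.zero_rpow (by positivity)]
    positivity
  change 0 < B at h0
  have hBL : B ≤ L := hb x0 (by simp)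
  set r := B / (6 * L) with hr
  have hr0 : 0 < r := by positivity
  have hr1 : r < 1 := by
    rw [hr, div_lt_one (by positivity)]; linarith
  have hlow : ∀ x : ℝ, |x - x0| ≤ r → B / 2 ≤ ‖f x‖ := by
    intro x hx
    have hd : dist (x : ℂ) (x0 : ℂ) = |x - x0| := by
      rw [Complex.dist_eq, ← Complex.ofReal_sub, Complex.norm_real, Real.norm_eq_abs]
    have hmap : Set.MapsTo f (Metric.ball (x0 : ℂ) 1) (Metric.ball (f x0) (3 * L)) := by
      intro w hw
      rw [Metric.mem_ball, dist_eq_norm]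
      have := norm_sub_le (f w) (f x0)
      have := hb w hw
      linarith
    have h1 := Complex.dist_le_div_mul_dist_of_mapsTo_ball (z := (x : ℂ)) hf.differentiableOn
      (hmap.mono_right Metric.ball_subset_closedBall)
      (by rw [Metric.mem_ball, hd]; linarith)
    rw [hd, dist_eq_norm] at h1
    have h2 : 3 * L / 1 * |x - x0| ≤ 3 * L * r := by
      rw [div_one]; gcongr
    have h3 : 3 * L * r = B / 2 := by rw [hr]; field_simp; norm_num
    have h4 := norm_sub_norm_le (f x0) (f x)
    rw [norm_sub_rev] at h4
    change B - _ ≤ _ at h4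
    linarith
  obtain ⟨a, ha⟩ : ∃ a : ℝ, ∀ x ∈ Set.Icc a (a + r / 2), |x - x0| ≤ r ∧ r / 2 ≤ |x| := by
    rcases le_total 0 x0 with h | h
    · refine ⟨x0 + r / 2, fun x hx => ⟨?_, ?_⟩⟩
      · rw [abs_le]; constructor <;> linarith [hx.1, hx.2]
      · exact le_trans (by linarith [hx.1]) (le_abs_self x)
    · refine ⟨x0 - r, fun x hx => ⟨?_, ?_⟩⟩
      · rw [abs_le]; constructor <;> linarith [hx.1, hx.2]
      · exact le_trans (by linarith [hx.2]) (neg_le_abs x)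
  have key : ENNReal.ofReal ((B / 2) ^ p * (r / 2) ^ α * (r / 2)) ≤ J := by
    calc ENNReal.ofReal ((B / 2) ^ p * (r / 2) ^ α * (r / 2))
        = ∫⁻ _ in Set.Icc a (a + r / 2), ENNReal.ofReal ((B / 2) ^ p * (r / 2) ^ α) := by
          rw [setLIntegral_const, Real.volume_Icc, ← ENNReal.ofReal_mul (by positivity)]
          congr 2; ring
      _ ≤ ∫⁻ t in Set.Icc a (a + r / 2), (‖f t‖₊ : ℝ≥0∞) ^ p * ENNReal.ofReal (|t| ^ α) := by
          refine setLIntegral_mono' measurableSet_Icc fun x hx => ?_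
          obtain ⟨h1, h2⟩ := ha x hx
          have h3 := hlow x h1
          rw [ENNReal.ofReal_mul (by positivity)]
          refine mul_le_mul' ?_ (ENNReal.ofReal_le_ofReal (by gcongr))
          rw [← ENNReal.ofReal_rpow_of_nonneg (by positivity) hp.le]
          refine ENNReal.rpow_le_rpow ?_ hp.le
          rw [← enorm_eq_nnnorm, ← ofReal_norm]
          exact ENNReal.ofReal_le_ofReal h3
      _ ≤ J := setLIntegral_le_lintegral _ _
  have key2 : (B / 2) ^ p * (r / 2) ^ α * (r / 2) ≤ J.toReal :=
    (ENNReal.ofReal_le_iff_le_toReal hJ.ne).1 key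
  have e1 : (B / 2) ^ p * (r / 2) ^ α * (r / 2) * (2 ^ p * 12 ^ (1 + α) * L ^ (1 + α))
      = B ^ (p + (1 + α)) := by
    have hr2 : r / 2 = B / (12 * L) := by rw [hr]; field_simp; norm_num
    have : (r / 2) ^ α * (r / 2) = (r / 2) ^ (1 + α) := by
      rw [add_comm, Real.rpow_add_one (by positivity)]
    rw [mul_assoc _ _ (r / 2), this, hr2, Real.div_rpow h0.le (by positivity),
      Real.div_rpow h0.le (by positivity), Real.mul_rpow (by positivity) hL.le,
      Real.rpow_add h0 p]
    have : (0:ℝ) < 2 ^ p := by positivity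
    have : (0:ℝ) < 12 ^ (1 + α) := by positivity
    have : (0:ℝ) < L ^ (1 + α) := by positivity
    generalize B ^ (1 + α) = b1 at *
    generalize L ^ (1 + α) = l1 at *
    generalize (12:ℝ) ^ (1 + α) = t1 at *
    field_simp
  rw [← e1]
  calc _ ≤ J.toReal * (2 ^ p * 12 ^ (1 + α) * L ^ (1 + α)) := by gcongr
    _ = _ := by ring

/-- growth helper -/
lemma growth {g : ℂ → ℂ} {C : ℝ} (hC : ∀ z, ‖g z‖ ≤ C * Real.exp (6 * ‖z‖)) (l : Filter ℂ) :
    ∃ c < (2:ℝ), ∃ B, g =O[l] fun z => Real.exp (B * ‖z‖ ^ c) := by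
  refine ⟨1, by norm_num, 6, Asymptotics.IsBigO.of_bound C (Eventually.of_forall fun z => ?_)⟩
  rw [Real.rpow_one, Real.norm_eq_abs, Real.abs_exp]
  exact hC z

lemma quad {f : ℂ → ℂ} (hf : Differentiable ℂ f) (hev : ∀ z, f (-z) = f z) {D a : ℝ}
    (ha : 0 ≤ a) (ha2 : a ≤ 2)
    (hD : ∀ z, ‖f z‖ ≤ D * Real.exp (2 * ‖z‖)) (hR : ∀ x : ℝ, ‖f x‖ ≤ D * Real.exp (a * |x|))
    (z : ℂ) : ‖f z‖ ≤ D * Real.exp (a * |z.re| + 2 * |z.im|) := by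
  have hD0 : 0 ≤ D := by simpa using (norm_nonneg _).trans (hD 0)
  -- right half plane, both signs of the imaginary part
  have main : ∀ w : ℂ, 0 ≤ w.re → ‖f w‖ ≤ D * Real.exp (a * |w.re| + 2 * |w.im|) := by
    have nrm : ∀ (s : ℝ) (w : ℂ), ‖f w * Complex.exp (-(a * w) + s * 2 * Complex.I * w)‖
        = ‖f w‖ * Real.exp (-(a * w.re) - s * 2 * w.im) := by
      intro s w
      rw [norm_mul, Complex.norm_exp]
      congr 2
      simp
      ring
    have hd : ∀ s : ℝ, Differentiable ℂ
        fun w : ℂ => f w * Complex.exp (-(a * w) + s * 2 * Complex.I * w) := by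
      intro s; fun_prop
    have hgr : ∀ s : ℝ, |s| = 1 → ∀ w : ℂ,
        ‖f w * Complex.exp (-(a * w) + s * 2 * Complex.I * w)‖ ≤ D * Real.exp (6 * ‖w‖) := by
      intro s hs w
      rw [nrm]
      have h1 : -(a * w.re) ≤ 2 * ‖w‖ := by
        have := Complex.abs_re_le_norm w
        have := neg_abs_le w.re
        nlinarith [norm_nonneg w, abs_nonneg w.re]
      have h2 : - s * 2 * w.im ≤ 2 * ‖w‖ := by
        have := Complex.abs_im_le_norm w
        have h3 : |s * w.im| = |w.im| := by rw [abs_mul, hs, one_mul]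
        have := neg_abs_le (s * w.im)
        linarith
      calc _ ≤ D * Real.exp (2 * ‖w‖) * Real.exp (4 * ‖w‖) := by
            gcongr
            · exact hD w
            · linarith
        _ = _ := by rw [mul_assoc, ← Real.exp_add]; ring_nf
    have hre : ∀ (s x : ℝ), 0 ≤ x →
        ‖f x * Complex.exp (-(a * x) + s * 2 * Complex.I * x)‖ ≤ D := by
      intro s x hx
      rw [nrm]
      have := hR x
      rw [abs_of_nonneg hx] at this
      calc _ ≤ D * Real.exp (a * x) * Real.exp (-(a * x)) := by
            gcongr
            simp
        _ = D := by rw [mul_assoc, ← Real.exp_add]; simp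
    have him : ∀ (s x : ℝ), |s| = 1 → s * x = |x| →
        ‖f (x * Complex.I) * Complex.exp (-(a * (x * Complex.I)) + s * 2 * Complex.I * (x * Complex.I))‖ ≤ D := by
      intro s x hs hx
      rw [nrm]
      have := hD (x * Complex.I)
      rw [norm_mul, Complex.norm_I, Complex.norm_real, Real.norm_eq_abs, mul_one] at this
      calc _ ≤ D * Real.exp (2 * |x|) * Real.exp (-(2 * |x|)) := by
            gcongr
            simp
            linarith
        _ = D := by rw [mul_assoc, ← Real.exp_add]; simp
    have fin : ∀ (s : ℝ) (w : ℂ), 0 ≤ w.re → s * w.im = |w.im| →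
        ‖f w * Complex.exp (-(a * w) + s * 2 * Complex.I * w)‖ ≤ D →
        ‖f w‖ ≤ D * Real.exp (a * |w.re| + 2 * |w.im|) := by
      intro s w hw hs h
      rw [nrm] at h
      rw [abs_of_nonneg hw, ← hs]
      calc ‖f w‖ = ‖f w‖ * Real.exp (-(a * w.re) - s * 2 * w.im) *
            Real.exp (a * w.re + 2 * (s * w.im)) := by
            rw [mul_assoc, ← Real.exp_add]; ring_nf; simp
        _ ≤ _ := by gcongr
    intro w hw
    rcases le_total 0 w.im with hi | hi
    · refine fin 1 w hw (by rw [abs_of_nonneg hi, one_mul]) ?_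
      exact PhragmenLindelof.quadrant_I 
        (f := fun w : ℂ => f w * Complex.exp (-(a * w) + ((1 : ℝ) : ℂ) * 2 * Complex.I * w))
        (hd 1).diffContOnCl (growth (hgr 1 (by simp)) _)
        (fun x hx => hre 1 x hx) (fun x hx => him 1 x (by simp) (by rw [abs_of_nonneg hx, one_mul]))
        hw hi
    · refine fin (-1) w hw (by rw [abs_of_nonpos hi]; ring) ?_
      exact PhragmenLindelof.quadrant_IV 
        (f := fun w : ℂ => f w * Complex.exp (-(a * w) + (((-1) : ℝ) : ℂ) * 2 * Complex.I * w))
        (hd (-1)).diffContOnCl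
        (growth (hgr (-1) (by simp)) _)
        (fun x hx => hre (-1) x hx)
        (fun x hx => him (-1) x (by simp) (by rw [abs_of_nonpos hx]; ring))
        hw hi
  rcases le_total 0 z.re with h | h
  · exact main z h
  · have := main (-z) (by simpa using h)
    simpa [hev] using this

lemma half {f : ℂ → ℂ} (hf : Differentiable ℂ f) (hev : ∀ z, f (-z) = f z) {D M : ℝ}
    (hD : ∀ z, ‖f z‖ ≤ D * Real.exp (2 * ‖z‖)) (hR : ∀ x : ℝ, ‖f x‖ ≤ M)
    (z : ℂ) : ‖f z‖ ≤ M * Real.exp (2 * |z.im|) := by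
  have hD0 : 0 ≤ D := by simpa using (norm_nonneg _).trans (hD 0)
  have nrm : ∀ (w : ℂ), ‖f (Complex.I * w) * Complex.exp (-(2 * w))‖
      = ‖f (Complex.I * w)‖ * Real.exp (-(2 * w.re)) := by
    intro w
    rw [norm_mul, Complex.norm_exp]
    simp
  have hDI : ∀ w, ‖f (Complex.I * w)‖ ≤ D * Real.exp (2 * ‖w‖) := by
    intro w; simpa using hD (Complex.I * w)
  have hd : Differentiable ℂ fun w : ℂ => f (Complex.I * w) * Complex.exp (-(2 * w)) := by
    fun_prop
  have hgr : ∀ w : ℂ, ‖f (Complex.I * w) * Complex.exp (-(2 * w))‖ ≤ D * Real.exp (6 * ‖w‖) := by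
    intro w
    rw [nrm]
    have := Complex.abs_re_le_norm w
    have := neg_abs_le w.re
    have := norm_nonneg w
    calc _ ≤ D * Real.exp (2 * ‖w‖) * Real.exp (4 * ‖w‖) := by
          gcongr
          · exact hDI w
          · linarith
      _ = _ := by rw [mul_assoc, ← Real.exp_add]; ring_nf
  have main : ∀ w : ℂ, 0 ≤ w.re → ‖f (Complex.I * w)‖ ≤ M * Real.exp (2 * w.re) := by
    intro w hw
    have h := PhragmenLindelof.right_half_plane_of_bounded_on_real (C := M) hd.diffContOnCl
      (growth hgr _) ?_ ?_ hw
    · rw [nrm] at h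
      calc _ = ‖f (Complex.I * w)‖ * Real.exp (-(2 * w.re)) * Real.exp (2 * w.re) := by
            rw [mul_assoc, ← Real.exp_add]; simp
        _ ≤ _ := by gcongr
    · refine isBoundedUnder_of_eventually_le (a := D) ?_
      filter_upwards [eventually_ge_atTop 0] with x hx
      rw [nrm]
      have := hDI x
      rw [Complex.norm_real, Real.norm_eq_abs, abs_of_nonneg hx] at this
      calc _ ≤ D * Real.exp (2 * x) * Real.exp (-(2 * x)) := by
            gcongr
            simp
        _ = D := by rw [mul_assoc, ← Real.exp_add]; simp
    · intro x
      rw [nrm]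
      have e : Complex.I * (x * Complex.I) = ((-x : ℝ) : ℂ) := by
        push_cast
        linear_combination (x : ℂ) * Complex.I_mul_I
      rw [e]
      simpa using hR (-x)
  rcases le_total 0 z.im with h | h
  · have := main (-Complex.I * z) (by simpa using h)
    rw [abs_of_nonneg h]
    have e : Complex.I * (-Complex.I * z) = z := by
      linear_combination (-z) * Complex.I_mul_I
    rw [e] at this
    simpa using this
  · have := main (Complex.I * z) (by simpa using h)
    rw [abs_of_nonpos h]
    have e : Complex.I * (Complex.I * z) = -z := by
      linear_combination (z) * Complex.I_mul_I
    rw [e, hev] at this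
    simpa using this

lemma step {α : ℝ} (hα : 0 ≤ α) {p : ℝ} (hp : 0 < p) {f : ℂ → ℂ} (hf : Differentiable ℂ f)
    (hev : ∀ z, f (-z) = f z)
    (hJ : (∫⁻ t : ℝ, (‖f t‖₊ : ℝ≥0∞) ^ p * ENNReal.ofReal (|t| ^ α)) < ⊤)
    {D a : ℝ} (hD0 : 0 < D) (ha : 0 ≤ a) (ha2 : a ≤ 2)
    (hDK : 2 ^ p * 12 ^ (1 + α) *
      (∫⁻ t : ℝ, (‖f t‖₊ : ℝ≥0∞) ^ p * ENNReal.ofReal (|t| ^ α)).toReal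
        * Real.exp 4 ^ (1 + α) ≤ D ^ p)
    (hD : ∀ z, ‖f z‖ ≤ D * Real.exp (2 * ‖z‖)) (hR : ∀ x : ℝ, ‖f x‖ ≤ D * Real.exp (a * |x|))
    (x : ℝ) : ‖f x‖ ≤ D * Real.exp (a * ((1 + α) / (p + (1 + α))) * |x|) := by
  have hL : 0 < D * Real.exp (a * |x|) * Real.exp 4 := by positivity
  have h := core hα hp hf hL x ?_ hJ
  · set K := 2 ^ p * 12 ^ (1 + α) *
      (∫⁻ t : ℝ, (‖f t‖₊ : ℝ≥0∞) ^ p * ENNReal.ofReal (|t| ^ α)).toReal with hK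
    refine (Real.rpow_le_rpow_iff (norm_nonneg _) (by positivity)
      (z := p + (1 + α)) (by positivity)).1 (h.trans ?_)
    rw [Real.mul_rpow (by positivity) (by positivity), Real.mul_rpow (by positivity) (by positivity),
      Real.mul_rpow (by positivity) (by positivity), Real.rpow_add hD0 p, ← Real.exp_mul (a * |x|),
      ← Real.exp_mul (a * _ * |x|)]
    have e : a * ((1 + α) / (p + (1 + α))) * |x| * (p + (1 + α)) = a * |x| * (1 + α) := by
      field_simp
    rw [e]
    calc _ = (K * Real.exp 4 ^ (1 + α)) * (D ^ (1 + α) * Real.exp (a * |x| * (1 + α))) := by ring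
      _ ≤ D ^ p * (D ^ (1 + α) * Real.exp (a * |x| * (1 + α))) := by gcongr
      _ = _ := by ring
  · intro w hw
    rw [Metric.mem_ball, Complex.dist_eq] at hw
    refine (quad hf hev ha ha2 hD hR w).trans ?_
    rw [mul_assoc, ← Real.exp_add]
    have h1 := Complex.abs_re_le_norm (w - x)
    have h2 := Complex.abs_im_le_norm (w - x)
    simp only [Complex.sub_re, Complex.sub_im, Complex.ofReal_re, Complex.ofReal_im, sub_zero]
      at h1 h2
    have h3 := abs_sub_abs_le_abs_sub w.re x
    refine mul_le_mul_of_nonneg_left (Real.exp_le_exp.2 ?_) hD0.le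
    have h4 : a * |w.re| ≤ a * (|x| + 1) := mul_le_mul_of_nonneg_left (by linarith) ha
    linarith

lemma bdd {α : ℝ} (hα : 0 ≤ α) {p : ℝ} (hp : 0 < p) {f : ℂ → ℂ} (hf : Differentiable ℂ f)
    (hev : ∀ z, f (-z) = f z)
    (hJ : (∫⁻ t : ℝ, (‖f t‖₊ : ℝ≥0∞) ^ p * ENNReal.ofReal (|t| ^ α)) < ⊤)
    {C : ℝ} (hC : ∀ z, ‖f z‖ ≤ C * Real.exp (2 * ‖z‖)) : ∃ D, ∀ x : ℝ, ‖f x‖ ≤ D := by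
  set K := 2 ^ p * 12 ^ (1 + α) *
      (∫⁻ t : ℝ, (‖f t‖₊ : ℝ≥0∞) ^ p * ENNReal.ofReal (|t| ^ α)).toReal
        * Real.exp 4 ^ (1 + α) with hK
  have hK0 : 0 ≤ K := by positivity
  set D := max (max C 1) (K ^ (1 / p)) with hDdef
  have hD1 : 1 ≤ D := (le_max_right _ _).trans (le_max_left _ _)
  have hCD : C ≤ D := (le_max_left _ _).trans (le_max_left _ _)
  have hD0 : 0 < D := by linarith
  have hDK : K ≤ D ^ p := by
    calc K = (K ^ (1 / p)) ^ p := by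
          rw [← Real.rpow_mul hK0, one_div, inv_mul_cancel₀ hp.ne', Real.rpow_one]
      _ ≤ D ^ p := Real.rpow_le_rpow (by positivity) (le_max_right _ _) hp.le
  have hD : ∀ z, ‖f z‖ ≤ D * Real.exp (2 * ‖z‖) := fun z => (hC z).trans (by gcongr)
  set θ := (1 + α) / (p + (1 + α)) with hθ
  have hθ0 : 0 ≤ θ := by positivity
  have hθ1 : θ < 1 := by rw [hθ, div_lt_one (by positivity)]; linarith
  have it : ∀ n : ℕ, ∀ x : ℝ, ‖f x‖ ≤ D * Real.exp (2 * θ ^ n * |x|) := by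
    intro n
    induction n with
    | zero => intro x; simpa using hD x
    | succ n ih =>
      intro x
      have h1 : θ ^ n ≤ 1 := pow_le_one₀ hθ0 hθ1.le
      have := step hα hp hf hev hJ hD0 (a := 2 * θ ^ n) (by positivity) (by linarith) hDK hD ih x
      rwa [pow_succ, ← mul_assoc]
  refine ⟨D, fun x => ?_⟩
  have ht : Tendsto (fun n : ℕ => D * Real.exp (2 * θ ^ n * |x|)) atTop (𝓝 D) := by
    have h1 := tendsto_pow_atTop_nhds_zero_of_lt_one hθ0 hθ1
    have h2 := (Real.continuous_exp.tendsto _).comp ((h1.const_mul 2).mul_const |x|)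
    simpa using h2.const_mul D
  exact ge_of_tendsto' ht fun n => it n x

/-- **Lemma 5.2a (b), Nikolskii-type inequality.**  For `α ≥ 0` and `p ∈ (0,∞)` there
is a constant `C(p,α)` such that every even entire function `f` of exponential type `1`
with `∫_ℝ |f(t)|^p |t|^α dt < ∞` satisfies
`sup_{t∈ℝ} |f(t)| ≤ C(p,α) (∫_ℝ |f(t)|^p |t|^α dt)^{1/p}`. -/
theorem nikolskii_weighted {α : ℝ} (hα : 0 ≤ α) {p : ℝ} (hp : 0 < p) :
    ∃ C : ℝ, ∀ f : ℂ → ℂ, SphericalType1 1 f → (∀ z : ℂ, f (-z) = f z) →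
      (∫⁻ t : ℝ, (‖f t‖₊ : ℝ≥0∞) ^ p * ENNReal.ofReal (|t| ^ α)) < ⊤ →
      ∀ t : ℝ,
        ‖f t‖ ≤ C *
          ((∫⁻ s : ℝ, (‖f s‖₊ : ℝ≥0∞) ^ p * ENNReal.ofReal (|s| ^ α)).toReal) ^ (1 / p) := by
  refine ⟨(2 ^ p * 12 ^ (1 + α) * Real.exp 2 ^ (1 + α)) ^ (1 / p), ?_⟩
  intro f ⟨hf, hexp⟩ hev hJ t
  obtain ⟨C, hC⟩ := hexp 1 one_pos
  replace hC : ∀ z, ‖f z‖ ≤ C * Real.exp (2 * ‖z‖) := by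
    intro z; convert hC z using 4; norm_num
  obtain ⟨D, hD⟩ := bdd hα hp hf hev hJ hC
  set J := (∫⁻ s : ℝ, (‖f s‖₊ : ℝ≥0∞) ^ p * ENNReal.ofReal (|s| ^ α)).toReal with hJdef
  have hJ0 : 0 ≤ J := ENNReal.toReal_nonneg
  have hbd : BddAbove (Set.range fun x : ℝ => ‖f x‖) := ⟨D, by rintro _ ⟨x, rfl⟩; exact hD x⟩
  set M := ⨆ x : ℝ, ‖f x‖ with hM
  have hle : ∀ x : ℝ, ‖f x‖ ≤ M := fun x => le_ciSup hbd x
  refine (hle t).trans ?_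
  have hM0 : 0 ≤ M := (norm_nonneg _).trans (hle t)
  rcases hM0.eq_or_lt with h0 | h0
  · rw [← h0]; positivity
  set K := 2 ^ p * 12 ^ (1 + α) * Real.exp 2 ^ (1 + α) with hK
  have hK0 : 0 ≤ K := by positivity
  have hs : 0 < p + (1 + α) := by positivity
  have hpt : ∀ x : ℝ, ‖f x‖ ^ (p + (1 + α)) ≤ K * J * M ^ (1 + α) := by
    intro x
    have h := core hα hp hf (L := M * Real.exp 2) (by positivity) x ?_ hJ
    · rw [Real.mul_rpow (by positivity) (by positivity)] at h
      refine h.trans (le_of_eq ?_)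
      rw [hK, hJdef]; ring
    · intro w hw
      rw [Metric.mem_ball, Complex.dist_eq] at hw
      refine (half hf hev hC hle w).trans ?_
      have h2 := Complex.abs_im_le_norm (w - x)
      simp only [Complex.sub_im, Complex.ofReal_im, sub_zero] at h2
      gcongr
      linarith
  have hMs : M ^ (p + (1 + α)) ≤ K * J * M ^ (1 + α) := by
    rw [← Real.le_rpow_inv_iff_of_pos hM0 (by positivity) hs]
    refine ciSup_le fun x => ?_
    rw [Real.le_rpow_inv_iff_of_pos (norm_nonneg _) (by positivity) hs]
    exact hpt x
  have hMp : M ^ p ≤ K * J := by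
    rw [Real.rpow_add h0 p] at hMs
    exact le_of_mul_le_mul_right hMs (by positivity)
  rw [← Real.mul_rpow hK0 hJ0]
  calc M = (M ^ p) ^ (1 / p) := by
        rw [← Real.rpow_mul hM0, one_div, mul_inv_cancel₀ hp.ne', Real.rpow_one]
    _ ≤ _ := Real.rpow_le_rpow (by positivity) hMp (by positivity)
end
end

section
/- Let ν ≥ −1/2 and let {f_n}_{n=1}^∞ be a sequence of even entire functions f_n(z) = Σ_{k=0}^∞ c_{k,n} z^{2k} with the property that for every δ > 0 there exists a constant C(δ), independent of n and k, such that |c_{k,n}| ≤ C(δ)(1+δ)^{2k}/(2k)! for all n ∈ ℕ and k ≥ 0. Then there exist a subsequence {f_{n_s}} and a function f_0 ∈ E_{1,1,e} such that for every integer l ≥ 0, f_{n_s}^{(l)} → f_0^{(l)} and (Be_ν)^l(f_{n_s}) → (Be_ν)^l(f_0) as s → ∞, uniformly on every compact subset of ℂ. -/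
open MeasureTheory Filter Topology ENNReal

noncomputable section

/-- The Bessel operator `Be_ν(φ)(r) = φ''(r) + (2ν+1)φ'(r)/r`, with the value at `0`
given by continuity (for even analytic `φ` this is `(2ν+2)φ''(0)`). -/
def besselOp (ν : ℝ) (f : ℂ → ℂ) : ℂ → ℂ := fun z =>
  if z = 0 then (2*ν+2) * deriv (deriv f) 0
  else deriv (deriv f) z + (2*ν+1) * (deriv f z / z)

lemma bc_differentiable (a : ℕ → ℂ) (g : ℂ → ℂ) (C : ℝ)
    (hg : ∀ z : ℂ, HasSum (fun k : ℕ => a k * z ^ (2 * k)) (g z))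
    (ha : ∀ k, ‖a k‖ ≤ C * (1 + 1) ^ (2 * k) / (2 * k).factorial) : Differentiable ℂ g := by
  intro z
  have hd : DifferentiableOn ℂ (fun w : ℂ => ∑' k : ℕ, a k * w ^ (2 * k))
      (Metric.ball 0 (‖z‖ + 1)) := by
    apply Complex.differentiableOn_tsum_of_summable_norm
      (u := fun k => C * ((2 * (‖z‖ + 1)) ^ (2 * k) / (2 * k).factorial))
    · exact ((Real.hasSum_cosh _).summable.mul_left C)
    · intro k
      fun_prop
    · exact Metric.isOpen_ball
    · intro k w hw
      have hw' : ‖w‖ ≤ ‖z‖ + 1 := by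
        have := mem_ball_zero_iff.1 hw
        exact this.le
      rw [norm_mul, norm_pow]
      calc ‖a k‖ * ‖w‖ ^ (2 * k)
          ≤ (C * (1 + 1) ^ (2 * k) / (2 * k).factorial) * (‖z‖ + 1) ^ (2 * k) := by
            have := (norm_nonneg _).trans (ha k)
            gcongr
            exact ha k
        _ = _ := by rw [mul_pow]; norm_num; ring
  have heq : g = fun w : ℂ => ∑' k : ℕ, a k * w ^ (2 * k) := by
    funext w
    exact (hg w).tsum_eq.symm
  rw [heq]
  exact hd.differentiableAt (Metric.isOpen_ball.mem_nhds (by simp))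

/-- entire and even -/
def BcEven (g : ℂ → ℂ) : Prop := Differentiable ℂ g ∧ ∀ z, g (-z) = g z

lemma bc_deriv_diff {g : ℂ → ℂ} (h : Differentiable ℂ g) : Differentiable ℂ (deriv g) := by
  intro z
  have := (h.differentiableOn (s := Set.univ)).deriv isOpen_univ
  exact this.differentiableAt Filter.univ_mem

lemma bc_deriv_neg {g : ℂ → ℂ} (h : ∀ z, g (-z) = g z) (z : ℂ) :
    deriv g (-z) = - deriv g z := by
  have h1 : (fun x => g (-x)) = g := funext h
  have h2 := deriv_comp_neg g z
  rw [h1] at h2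
  rw [h2, neg_neg]

lemma bc_deriv_neg' {g : ℂ → ℂ} (h : ∀ z, g (-z) = - g z) (z : ℂ) :
    deriv g (-z) = deriv g z := by
  have h1 : (fun x => g (-x)) = fun x => - g x := funext h
  have h2 := deriv_comp_neg g z
  rw [h1, deriv.fun_neg] at h2
  exact (neg_injective h2).symm

lemma bc_deriv_zero {g : ℂ → ℂ} (h : ∀ z, g (-z) = g z) : deriv g 0 = 0 := by
  have := bc_deriv_neg h 0
  rw [neg_zero] at this
  exact self_eq_neg.1 this

lemma bc_bessel_eq (ν : ℝ) {g : ℂ → ℂ} (h : BcEven g) :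
    besselOp ν g = fun z => deriv (deriv g) z + (2*ν+1) * dslope (deriv g) 0 z := by
  funext z
  unfold besselOp
  split_ifs with hz
  · subst hz
    rw [dslope_same]; ring
  · rw [dslope_of_ne _ hz, slope_def_field, bc_deriv_zero h.2]; simp

lemma bc_dslope_diff {g : ℂ → ℂ} (h : Differentiable ℂ g) : Differentiable ℂ (dslope g 0) := by
  have := (Complex.differentiableOn_dslope (c := (0:ℂ)) (s := Set.univ) (f := g) univ_mem).2
    h.differentiableOn
  exact differentiableOn_univ.1 this

lemma bc_bessel_even (ν : ℝ) {g : ℂ → ℂ} (h : BcEven g) : BcEven (besselOp ν g) := by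
  refine ⟨?_, ?_⟩
  · rw [bc_bessel_eq ν h]
    have h1 := bc_deriv_diff h.1
    exact (bc_deriv_diff h1).add ((bc_dslope_diff h1).const_mul _)
  · intro z
    unfold besselOp
    simp only [neg_eq_zero]
    rw [bc_deriv_neg h.2, bc_deriv_neg' (bc_deriv_neg h.2), neg_div_neg_eq]

lemma bc_tlu_deriv {F : ℕ → ℂ → ℂ} {g : ℂ → ℂ} (hF : ∀ n, Differentiable ℂ (F n))
    (h : TendstoLocallyUniformlyOn F g atTop Set.univ) :
    TendstoLocallyUniformlyOn (fun n => deriv (F n)) (deriv g) atTop Set.univ :=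
  h.deriv (Eventually.of_forall fun n => (hF n).differentiableOn) isOpen_univ

lemma bc_tlu_dslope {F : ℕ → ℂ → ℂ} {g : ℂ → ℂ} (hF : ∀ n, Differentiable ℂ (F n))
    (hg : Differentiable ℂ g)
    (h : TendstoLocallyUniformlyOn F g atTop Set.univ) :
    TendstoLocallyUniformlyOn (fun n => dslope (F n) 0) (dslope g 0) atTop Set.univ := by
  have hd := bc_tlu_deriv hF h
  rw [tendstoLocallyUniformlyOn_iff_forall_isCompact isOpen_univ] at hd ⊢
  intro K _ hK
  obtain ⟨R, hR⟩ := hK.isBounded.subset_closedBall 0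
  have hd' := hd (Metric.closedBall 0 R) (Set.subset_univ _) (isCompact_closedBall 0 R)
  rw [Metric.tendstoUniformlyOn_iff] at hd' ⊢
  intro ε hε
  filter_upwards [hd' (ε / 2) (half_pos hε)] with n hn z hz
  have hzR := hR hz
  have hR0 : 0 ≤ R := (dist_nonneg).trans hzR
  rw [dist_eq_norm]
  refine lt_of_le_of_lt ?_ (half_lt_self hε)
  by_cases h0 : z = 0
  · subst h0
    rw [dslope_same, dslope_same, ← dist_eq_norm]
    exact (hn 0 hzR).le
  · rw [dslope_of_ne _ h0, dslope_of_ne _ h0, slope_def_field, slope_def_field, ← sub_div,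
      norm_div, div_le_iff₀ (by simpa using h0)]
    have key := (convex_closedBall (0:ℂ) R).norm_image_sub_le_of_norm_deriv_le
      (f := fun w => g w - F n w) (C := ε / 2) (x := 0) (y := z)
      (fun w _ => ((hg w).sub (hF n w)))
      (fun w hw => by
        rw [deriv_fun_sub (hg w) (hF n w), ← dist_eq_norm]
        exact (hn w hw).le) (by simpa using hR0) hzR
    have e : g z - g 0 - (F n z - F n 0) = g z - F n z - (g 0 - F n 0) := by ring
    rw [e]
    simpa only [sub_zero] using key

lemma bc_tlu_bessel (ν : ℝ) {F : ℕ → ℂ → ℂ} {g : ℂ → ℂ} (hF : ∀ n, BcEven (F n))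
    (hg : BcEven g) (h : TendstoLocallyUniformlyOn F g atTop Set.univ) :
    TendstoLocallyUniformlyOn (fun n => besselOp ν (F n)) (besselOp ν g) atTop Set.univ := by
  have h1 := bc_tlu_deriv (fun n => (hF n).1) h
  have h2 := bc_tlu_deriv (fun n => bc_deriv_diff (hF n).1) h1
  have h3 := bc_tlu_dslope (fun n => bc_deriv_diff (hF n).1) (bc_deriv_diff hg.1) h1
  have e : (fun n => besselOp ν (F n)) = fun n z => deriv (deriv (F n)) z +
      (2*ν+1) * dslope (deriv (F n)) 0 z := by
    funext n
    exact bc_bessel_eq ν (hF n)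
  rw [e, bc_bessel_eq ν hg]
  rw [tendstoLocallyUniformlyOn_iff_forall_isCompact isOpen_univ] at h2 h3 ⊢
  intro K hs hK
  have h3' := (uniformContinuous_const_smul ((2*ν+1 : ℂ))).comp_tendstoUniformlyOn (h3 K hs hK)
  exact (h2 K hs hK).add h3'

lemma bc_main {ν : ℝ} {F : ℕ → ℂ → ℂ} {g : ℂ → ℂ} (hF : ∀ n, BcEven (F n))
    (hg : BcEven g) (h : TendstoLocallyUniformlyOn F g atTop Set.univ) (l : ℕ) :
    TendstoLocallyUniformlyOn (fun n => iteratedDeriv l (F n)) (iteratedDeriv l g)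
      atTop Set.univ ∧
    TendstoLocallyUniformlyOn (fun n => (besselOp ν)^[l] (F n)) ((besselOp ν)^[l] g)
      atTop Set.univ := by
  have A : ∀ l, ∀ u : ℂ → ℂ, Differentiable ℂ u → Differentiable ℂ (iteratedDeriv l u) := by
    intro l u hu
    induction l with
    | zero => simpa using hu
    | succ l ih => rw [iteratedDeriv_succ]; exact bc_deriv_diff ih
  have B : ∀ l, ∀ u : ℂ → ℂ, BcEven u → BcEven ((besselOp ν)^[l] u) := by
    intro l u hu
    induction l with
    | zero => simpa using hu
    | succ l ih => rw [Function.iterate_succ_apply']; exact bc_bessel_even ν ih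
  induction l with
  | zero => simpa using h
  | succ l ih =>
    refine ⟨?_, ?_⟩
    · simp only [iteratedDeriv_succ]
      exact bc_tlu_deriv (fun n => A l _ (hF n).1) ih.1
    · simp only [Function.iterate_succ_apply']
      exact bc_tlu_bessel ν (fun n => B l _ (hF n)) (B l _ hg) ih.2

/-- **Lemma 5.3 (compactness).**  Let `ν ≥ -1/2` and let `fₙ(z) = Σ_k c_{k,n} z^{2k}`
be even entire functions whose coefficients satisfy: for every `δ > 0` there is a
constant `C(δ)`, independent of `n` and `k`, with `|c_{k,n}| ≤ C(δ)(1+δ)^{2k}/(2k)!`.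
Then some subsequence converges to a function `f₀ ∈ E_{1,1,e}`, together with all
derivatives and all Bessel iterates, uniformly on every compact subset of `ℂ`. -/
theorem bessel_compactness {ν : ℝ} (hν : -(1/2 : ℝ) ≤ ν)
    (c : ℕ → ℕ → ℂ) (f : ℕ → ℂ → ℂ)
    (hf : ∀ n : ℕ, ∀ z : ℂ, HasSum (fun k : ℕ => c n k * z ^ (2 * k)) (f n z))
    (hc : ∀ δ : ℝ, 0 < δ → ∃ C : ℝ, ∀ (n k : ℕ),
      ‖c n k‖ ≤ C * (1 + δ) ^ (2 * k) / (2 * k).factorial) :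
    ∃ ns : ℕ → ℕ, StrictMono ns ∧
      ∃ f₀ : ℂ → ℂ, SphericalType1 1 f₀ ∧ (∀ z : ℂ, f₀ (-z) = f₀ z) ∧
        ∀ (l : ℕ) (K : Set ℂ), IsCompact K →
          TendstoUniformlyOn (fun s z => iteratedDeriv l (f (ns s)) z)
            (iteratedDeriv l f₀) atTop K ∧
          TendstoUniformlyOn (fun s z => (besselOp ν)^[l] (f (ns s)) z)
            ((besselOp ν)^[l] f₀) atTop K := by
  choose! C hC using hc
  have hC0 : ∀ δ : ℝ, 0 < δ → 0 ≤ C δ := fun δ hδ => by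
    have := (norm_nonneg _).trans (hC δ hδ 0 0)
    simpa using this
  -- extraction of a coefficientwise convergent subsequence
  obtain ⟨a, ns, hns, hlim⟩ : ∃ (a : ℕ → ℂ) (ns : ℕ → ℕ), StrictMono ns ∧
      ∀ k, Tendsto (fun s => c (ns s) k) atTop (𝓝 (a k)) := by
    have hcomp : IsCompact (Set.pi Set.univ fun k : ℕ =>
        Metric.closedBall (0:ℂ) (C 1 * (1 + 1) ^ (2 * k) / (2 * k).factorial)) :=
      isCompact_univ_pi fun k => isCompact_closedBall _ _
    obtain ⟨a, -, ns, hns, ha⟩ := hcomp.tendsto_subseq (x := c) (fun n k _ => by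
      simpa using hC 1 one_pos n k)
    exact ⟨a, ns, hns, fun k => (tendsto_pi_nhds.1 ha) k⟩
  have ha : ∀ δ : ℝ, 0 < δ → ∀ k, ‖a k‖ ≤ C δ * (1 + δ) ^ (2 * k) / (2 * k).factorial :=
    fun δ hδ k => le_of_tendsto (hlim k).norm (Eventually.of_forall fun s => hC δ hδ (ns s) k)
  have hmaj : ∀ δ : ℝ, ∀ r : ℝ, HasSum (fun k : ℕ =>
      (C δ * (1 + δ) ^ (2 * k) / (2 * k).factorial) * r ^ (2 * k))
      (C δ * Real.cosh ((1 + δ) * r)) := fun δ r => by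
    refine ((Real.hasSum_cosh ((1 + δ) * r)).mul_left (C δ)).congr_fun ?_
    intro k
    rw [mul_pow]; ring
  have hterm : ∀ δ : ℝ, 0 < δ → ∀ (z : ℂ) (k : ℕ), ‖a k * z ^ (2 * k)‖ ≤
      (C δ * (1 + δ) ^ (2 * k) / (2 * k).factorial) * ‖z‖ ^ (2 * k) := fun δ hδ z k => by
    rw [norm_mul, norm_pow]
    gcongr
    exact ha δ hδ k
  let f₀ : ℂ → ℂ := fun z => ∑' k : ℕ, a k * z ^ (2 * k)
  have hf₀ : ∀ z, HasSum (fun k : ℕ => a k * z ^ (2 * k)) (f₀ z) := fun z =>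
    (Summable.of_norm_bounded (hmaj 1 ‖z‖).summable (hterm 1 one_pos z)).hasSum
  have hg : BcEven f₀ := by
    refine ⟨bc_differentiable a f₀ (C 1) hf₀ (ha 1 one_pos), fun z => ?_⟩
    simp only [f₀, pow_mul, neg_sq]
  have hF : ∀ s, BcEven (f (ns s)) := by
    intro s
    refine ⟨bc_differentiable (c (ns s)) _ (C 1) (hf (ns s)) (hC 1 one_pos (ns s)), fun z => ?_⟩
    rw [← (hf (ns s) z).tsum_eq, ← (hf (ns s) (-z)).tsum_eq]
    simp only [pow_mul, neg_sq]
  have hconv : TendstoLocallyUniformlyOn (fun s => f (ns s)) f₀ atTop Set.univ := by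
    rw [tendstoLocallyUniformlyOn_iff_forall_isCompact isOpen_univ]
    intro K _ hK
    obtain ⟨R, hR⟩ := hK.isBounded.subset_closedBall 0
    have hb : ∀ s k, ‖a k - c (ns s) k‖ * |R| ^ (2 * k) ≤
        2 * ((C 1 * (1 + 1) ^ (2 * k) / (2 * k).factorial) * |R| ^ (2 * k)) := by
      intro s k
      rw [← mul_assoc]
      gcongr
      refine (norm_sub_le _ _).trans ?_
      linarith [ha 1 one_pos k, hC 1 one_pos (ns s) k]
    have hS := (hmaj 1 |R|).summable.mul_left 2
    have hsum : ∀ s, Summable fun k => ‖a k - c (ns s) k‖ * |R| ^ (2 * k) := fun s =>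
      Summable.of_nonneg_of_le (fun k => by positivity) (hb s) hS
    have ht : Tendsto (fun s => ∑' k, ‖a k - c (ns s) k‖ * |R| ^ (2 * k)) atTop (𝓝 0) := by
      have := tendsto_tsum_of_dominated_convergence (𝓕 := atTop)
        (f := fun s k => ‖a k - c (ns s) k‖ * |R| ^ (2 * k)) (g := fun _ => (0:ℝ)) hS
        (fun k => by
          have h1 : Tendsto (fun s => a k - c (ns s) k) atTop (𝓝 (a k - a k)) :=
            tendsto_const_nhds.sub (hlim k)
          simpa using h1.norm.mul_const (|R| ^ (2 * k)))
        (Eventually.of_forall fun s k => by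
          rw [Real.norm_of_nonneg (by positivity)]
          exact hb s k)
      simpa using this
    rw [Metric.tendstoUniformlyOn_iff]
    intro ε hε
    filter_upwards [ht.eventually_lt_const hε] with s hs z hz
    have hzR : ‖z‖ ≤ |R| := (mem_closedBall_zero_iff.1 (hR hz)).trans (le_abs_self R)
    rw [dist_eq_norm]
    refine lt_of_le_of_lt ?_ hs
    have hd := (hf₀ z).sub (hf (ns s) z)
    rw [← hd.tsum_eq]
    refine tsum_of_norm_bounded (hsum s).hasSum fun k => ?_
    rw [← sub_mul, norm_mul, norm_pow]
    gcongr
  refine ⟨ns, hns, f₀, ⟨hg.1, fun ε hε => ⟨C ε, fun z => ?_⟩⟩, hg.2, fun l K hK => ?_⟩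
  · have h1 := tsum_of_norm_bounded (hmaj ε ‖z‖) (hterm ε hε z)
    refine h1.trans (mul_le_mul_of_nonneg_left ?_ (hC0 ε hε))
    rw [one_mul, Real.cosh_eq]
    have : Real.exp (-((1 + ε) * ‖z‖)) ≤ Real.exp ((1 + ε) * ‖z‖) := by
      apply Real.exp_le_exp.2
      have : 0 ≤ (1 + ε) * ‖z‖ := by positivity
      linarith
    linarith
  · have := bc_main (ν := ν) hF hg hconv l
    rw [tendstoLocallyUniformlyOn_iff_forall_isCompact isOpen_univ,
      tendstoLocallyUniformlyOn_iff_forall_isCompact isOpen_univ] at this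
    exact ⟨this.1 K (Set.subset_univ _) hK, this.2 K (Set.subset_univ _) hK⟩
end
end

section
/- Let ε ∈ (0,1/2), p ∈ (0,∞), α ≥ 0, and β > −1. Then there exists a constant C(α,β,p,ε) such that for every n ≥ 1, every polynomial P ∈ P_{n,1}, and every integer k ≥ 0: (i) sup_{|t| ≤ 1−ε} |P(t)| ≤ C(α,β,p,ε)·n^{(α+1)/p}·‖P‖_{L_{p,|t|^α(1−t²)^β}([−1,1])}, and (ii) |P^{(k)}(0)| ≤ C(α,β,p,ε)·(1−ε)^{−k}·n^{k+(α+1)/p}·‖P‖_{L_{p,|t|^α(1−t²)^β}([−1,1])}. -/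
open MeasureTheory Filter Topology Polynomial ENNReal

noncomputable section

/-- The weighted norm `(∫_{[-1,1]} |f|^p |t|^α (1-t²)^β dt)^{1/p}`
(essential supremum for `p = ∞`), as an extended nonnegative real. -/
def wNorm (p : ℝ≥0∞) (α β : ℝ) (f : ℝ → ℂ) : ℝ≥0∞ :=
  eLpNorm f p
    ((volume.restrict (Set.Icc (-1 : ℝ) 1)).withDensity
      fun t => ENNReal.ofReal (|t| ^ α * (1 - t ^ 2) ^ β))

lemma mn_joukowski {n : ℕ} {P : Polynomial ℂ} (hP : P.natDegree ≤ n) {w : ℂ} (hw : w ≠ 0) :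
    ∑ j ∈ Finset.range (n + 1), P.coeff j * w ^ (n - j) * ((w ^ 2 + 1) / 2) ^ j
      = w ^ n * P.eval ((w + w⁻¹) / 2) := by
  rw [Polynomial.eval_eq_sum_range' (Nat.lt_succ_of_le hP), Finset.mul_sum]
  refine Finset.sum_congr rfl fun j hj => ?_
  have hj' : j ≤ n := Nat.lt_succ_iff.mp (Finset.mem_range.mp hj)
  have h1 : (w ^ 2 + 1) / 2 = w * ((w + w⁻¹) / 2) := by field_simp
  have h2 : w ^ n = w ^ (n - j) * w ^ j := by rw [← pow_add, Nat.sub_add_cancel hj']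
  rw [h1, mul_pow, h2]; ring

lemma mn_growth_disc {n : ℕ} {P : Polynomial ℂ} (hP : P.natDegree ≤ n) {M : ℝ}
    (hM : ∀ t : ℝ, |t| ≤ 1 → ‖P.eval (t : ℂ)‖ ≤ M) {w : ℂ} (hw : w ≠ 0) (hw1 : ‖w‖ ≤ 1) :
    ‖w‖ ^ n * ‖P.eval ((w + w⁻¹) / 2)‖ ≤ M := by
  rw [← norm_pow, ← norm_mul, ← mn_joukowski hP hw]
  refine Complex.norm_le_of_forall_mem_frontier_norm_le
    (f := fun w : ℂ => ∑ j ∈ Finset.range (n + 1),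
      P.coeff j * w ^ (n - j) * ((w ^ 2 + 1) / 2) ^ j)
    (U := Metric.ball 0 1) Metric.isBounded_ball ?_ ?_ ?_
  · apply Differentiable.diffContOnCl
    fun_prop
  · intro z hz
    rw [frontier_ball _ one_ne_zero] at hz
    have hz1 : ‖z‖ = 1 := by simpa using hz
    have hz0 : z ≠ 0 := by
      rintro rfl; simp at hz1
    show ‖∑ j ∈ Finset.range (n + 1), P.coeff j * z ^ (n - j) * ((z ^ 2 + 1) / 2) ^ j‖ ≤ M
    rw [mn_joukowski hP hz0, norm_mul, norm_pow, hz1, one_pow, one_mul]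
    have : (z + z⁻¹) / 2 = ((z.re : ℝ) : ℂ) := by
      rw [Complex.inv_eq_conj hz1, Complex.add_conj]
      push_cast; ring
    rw [this]
    exact hM _ (hz1 ▸ Complex.abs_re_le_norm z)
  · rw [closure_ball _ one_ne_zero]; simpa using hw1

lemma mn_growth_cos {n : ℕ} {P : Polynomial ℂ} (hP : P.natDegree ≤ n) {M : ℝ}
    (hM : ∀ t : ℝ, |t| ≤ 1 → ‖P.eval (t : ℂ)‖ ≤ M) (z : ℂ) :
    ‖P.eval (Complex.cos z)‖ ≤ M * Real.exp (n * |z.im|) := by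
  wlog h : 0 ≤ z.im generalizing z
  · have := this (-z) (by simp; linarith)
    simpa using this
  have hn : ‖Complex.exp (z * Complex.I)‖ = Real.exp (-z.im) := by
    rw [Complex.norm_exp]; simp
  have := mn_growth_disc hP hM (w := Complex.exp (z * Complex.I)) (Complex.exp_ne_zero _)
    (by rw [hn]; exact Real.exp_le_one_iff.mpr (by linarith))
  rw [hn, ← Complex.exp_neg, ← neg_mul] at this
  change _ * ‖P.eval (Complex.cos z)‖ ≤ M at this
  rw [abs_of_nonneg h]
  rw [← Real.exp_nat_mul] at this
  have e : Real.exp (n * -z.im) * Real.exp (n * z.im) = 1 := by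
    rw [← Real.exp_add]; simp
  calc ‖P.eval (Complex.cos z)‖
      = (Real.exp (n * -z.im) * ‖P.eval (Complex.cos z)‖) * Real.exp (n * z.im) := by
        rw [mul_right_comm, e, one_mul]
    _ ≤ _ := by gcongr

lemma mn_abs_im_le (z : ℂ) : |z.im| ≤ ‖Complex.sin z‖ := by
  have h : |Real.sinh z.im| ≤ ‖Complex.sin z‖ := by
    rw [Complex.norm_def]
    apply Real.le_sqrt_of_sq_le
    rw [sq_abs, Complex.normSq_apply]
    have hs : Complex.sin z = ((Real.sin z.re * Real.cosh z.im : ℝ) : ℂ)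
        + ((Real.cos z.re * Real.sinh z.im : ℝ) : ℂ) * Complex.I := by
      rw [Complex.sin_eq]; push_cast; ring
    rw [hs]
    simp only [Complex.add_re, Complex.add_im, Complex.mul_re, Complex.mul_im, Complex.ofReal_re,
      Complex.ofReal_im, Complex.I_re, Complex.I_im]
    have h1 := Real.sin_sq_add_cos_sq z.re
    have h2 := Real.cosh_sq z.im
    have h3 : (0:ℝ) ≤ Real.sin z.re ^ 2 := sq_nonneg _
    have e : Real.cos z.re ^ 2 = 1 - Real.sin z.re ^ 2 := by linarith
    ring_nf
    rw [e, h2]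
    nlinarith
  refine le_trans ?_ h
  rw [Real.abs_sinh]
  exact Real.self_le_sinh_iff.mpr (abs_nonneg _)

lemma mn_growth {n : ℕ} {P : Polynomial ℂ} (hP : P.natDegree ≤ n) {M : ℝ}
    (hM : ∀ t : ℝ, |t| ≤ 1 → ‖P.eval (t : ℂ)‖ ≤ M) (z : ℂ) :
    ‖P.eval z‖ ≤ M * Real.exp (n * ‖z‖) := by
  obtain ⟨w, rfl⟩ := Complex.sin_surjective z
  have hM0 : 0 ≤ M := (norm_nonneg _).trans (hM 0 (by simp))
  have := mn_growth_cos hP hM (Real.pi / 2 - w)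
  rw [Complex.cos_pi_div_two_sub] at this
  refine this.trans ?_
  gcongr
  have := mn_abs_im_le w
  simpa using this

lemma mn_lipschitz {N : ℕ} (hN : 1 ≤ N) {Q : Polynomial ℂ} (hQ : Q.natDegree ≤ N) {M : ℝ}
    (hM : ∀ t : ℝ, |t| ≤ 1 → ‖Q.eval (t : ℂ)‖ ≤ M) (x y : ℝ) :
    ‖Q.eval (Real.cos y : ℂ) - Q.eval (Real.cos x : ℂ)‖ ≤ 3 * M * N * |y - x| := by
  have hM0 : 0 ≤ M := (norm_nonneg _).trans (hM 0 (by simp))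
  have hN0 : (0:ℝ) < N := by exact_mod_cast hN
  have hd : Differentiable ℂ (fun z : ℂ => Q.eval (Complex.cos z)) :=
    Q.differentiable.comp Complex.differentiable_cos
  have hs : Convex ℝ {z : ℂ | z.im = 0} := by
    intro a ha b hb s t _ _ _
    simp only [Set.mem_ofPred_eq] at *
    simp [ha, hb]
  have := Convex.norm_image_sub_le_of_norm_deriv_le (𝕜 := ℂ)
    (f := fun z : ℂ => Q.eval (Complex.cos z)) (C := 3 * M * N) (x := (x : ℂ)) (y := (y : ℂ))
    (fun z _ => hd z) (s := {z : ℂ | z.im = 0}) ?_ hs (by simp) (by simp)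
  · simpa [← Complex.ofReal_sub, Complex.norm_real] using this
  · intro z hz
    have := Complex.norm_deriv_le_of_forall_mem_sphere_norm_le (c := z) (R := 1 / N)
      (C := M * 3) (f := fun z : ℂ => Q.eval (Complex.cos z)) (by positivity) hd.diffContOnCl ?_
    · refine this.trans (le_of_eq ?_)
      field_simp
    · intro w hw
      refine (mn_growth_cos hQ hM w).trans ?_
      gcongr
      have h1 : |w.im| ≤ 1 / N := by
        have := Complex.abs_im_le_norm (w - z)
        rw [Metric.mem_sphere, dist_eq_norm] at hw
        rw [hw] at this
        simp only [Set.mem_ofPred_eq] at hz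
        simpa [hz] using this
      have h2 : (N : ℝ) * |w.im| ≤ 1 := by
        calc (N : ℝ) * |w.im| ≤ N * (1 / N) := by gcongr
          _ = 1 := by field_simp
      exact (Real.exp_le_exp.mpr h2).trans (by linarith [Real.exp_one_lt_d9])

lemma mn_iteratedDeriv (P : Polynomial ℂ) (k : ℕ) :
    iteratedDeriv k (fun z : ℂ => P.eval z) = fun z => (derivative^[k] P).eval z := by
  induction k with
  | zero => simp
  | succ k ih =>
    rw [iteratedDeriv_succ, ih, Function.iterate_succ_apply']
    funext z
    exact Polynomial.deriv _

lemma mn_factorial (k : ℕ) (hk : 1 ≤ k) :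
    (k.factorial : ℝ) * Real.exp k ≤ Real.exp 1 * k * (k : ℝ) ^ k := by
  induction k, hk using Nat.le_induction with
  | base => simp
  | succ k hk ih =>
    have hk0 : (0:ℝ) < k := by exact_mod_cast hk
    have key : Real.exp 1 * (k : ℝ) ^ (k + 1) ≤ ((k : ℝ) + 1) ^ (k + 1) := by
      have h1 : 1 - 1 / ((k : ℝ) + 1) ≤ Real.exp (-(1 / ((k : ℝ) + 1))) := by
        have := Real.add_one_le_exp (-(1 / ((k : ℝ) + 1))); linarith
      have h2 : (1 - 1 / ((k : ℝ) + 1)) = k / (k + 1) := by field_simp; ring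
      rw [h2] at h1
      have h3 := pow_le_pow_left₀ (by positivity) h1 (k + 1)
      rw [← Real.exp_nat_mul, div_pow, div_le_iff₀ (by positivity)] at h3
      have h4 : ((k + 1 : ℕ) : ℝ) * -(1 / ((k : ℝ) + 1)) = -1 := by push_cast; field_simp
      rw [h4] at h3
      calc _ ≤ Real.exp 1 * (Real.exp (-1) * ((k : ℝ) + 1) ^ (k + 1)) := by gcongr
        _ = _ := by rw [← mul_assoc, ← Real.exp_add]; simp
    rw [Nat.factorial_succ]
    push_cast
    rw [Real.exp_add]
    calc ((k : ℝ) + 1) * k.factorial * (Real.exp k * Real.exp 1)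
        = (k.factorial * Real.exp k) * ((k + 1) * Real.exp 1) := by ring
      _ ≤ (Real.exp 1 * k * (k : ℝ) ^ k) * ((k + 1) * Real.exp 1) := by gcongr
      _ = (Real.exp 1 * (k : ℝ) ^ (k + 1)) * (Real.exp 1 * (k + 1)) := by ring
      _ ≤ ((k : ℝ) + 1) ^ (k + 1) * (Real.exp 1 * (k + 1)) := by gcongr
      _ = _ := by ring

/-- Derivatives at the origin. -/
lemma mn_deriv_zero {n : ℕ} (hn : 1 ≤ n) {P : Polynomial ℂ} (hP : P.natDegree ≤ n) {a M : ℝ}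
    (ha : 0 < a) (hM : ∀ t : ℝ, |t| ≤ a → ‖P.eval (t : ℂ)‖ ≤ M) (k : ℕ) (hk : 1 ≤ k) :
    ‖(derivative^[k] P).eval 0‖ ≤ Real.exp 1 * k * (n / a) ^ k * M := by
  have hM0 : 0 ≤ M := (norm_nonneg _).trans (hM 0 (by simp [ha.le]))
  have hn0 : (0:ℝ) < n := by exact_mod_cast hn
  have hk0 : (0:ℝ) < k := by exact_mod_cast hk
  have hg : ∀ z : ℂ, ‖P.eval z‖ ≤ M * Real.exp (n * (‖z‖ / a)) := by
    intro z
    have := mn_growth (P := P.comp (C (a : ℂ) * X)) (n := n) (M := M) ?_ ?_ (z / a)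
    · have ha' : (a : ℂ) ≠ 0 := by exact_mod_cast ha.ne'
      simpa [mul_div_cancel₀ z ha', abs_of_pos ha] using this
    · refine (Polynomial.natDegree_comp_le).trans ?_
      calc _ ≤ P.natDegree * 1 := Nat.mul_le_mul_left _ ((natDegree_C_mul_le _ _).trans natDegree_X_le)
        _ ≤ n := by simpa using hP
    · intro t ht
      have := hM (a * t) (by rw [abs_mul, abs_of_pos ha]; nlinarith)
      simpa using this
  have hc := Complex.norm_iteratedDeriv_le_of_forall_mem_sphere_norm_le (c := 0) (R := a * k / n)
    (C := M * Real.exp k) (f := fun z : ℂ => P.eval z) k (by positivity)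
    (P.differentiable.diffContOnCl) ?_
  · rw [mn_iteratedDeriv] at hc
    refine hc.trans ?_
    rw [div_le_iff₀ (by positivity)]
    have h1 := mn_factorial k hk
    have h2 : (n / a : ℝ) ^ k * (a * k / n) ^ k = (k : ℝ) ^ k := by
      rw [← mul_pow]; congr 1; field_simp
    calc (k.factorial : ℝ) * (M * Real.exp k) = (k.factorial * Real.exp k) * M := by ring
      _ ≤ (Real.exp 1 * k * (k : ℝ) ^ k) * M := by gcongr
      _ = _ := by rw [← h2]; ring
  · intro z hz
    refine (hg z).trans (le_of_eq ?_)
    have : ‖z‖ = a * k / n := by simpa using hz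
    rw [this]; congr 2; field_simp

/-- The `p`-th power of the weighted norm. -/
def mnInt (p α β : ℝ) (P : Polynomial ℂ) : ℝ≥0∞ :=
  ∫⁻ t in Set.Icc (-1 : ℝ) 1,
    ENNReal.ofReal (|t| ^ α * (1 - t ^ 2) ^ β) * ‖P.eval (t : ℂ)‖ₑ ^ p

lemma mn_cont (P : Polynomial ℂ) : Continuous fun t : ℝ => P.eval (t : ℂ) :=
  P.continuous.comp Complex.continuous_ofReal

lemma mn_meas (α β : ℝ) :
    Measurable fun t : ℝ => ENNReal.ofReal (|t| ^ α * (1 - t ^ 2) ^ β) := by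
  fun_prop

lemma mn_wNorm {p : ℝ} (hp : 0 < p) (α β : ℝ) (P : Polynomial ℂ) :
    wNorm (ENNReal.ofReal p) α β (fun t : ℝ => P.eval (t : ℂ)) = mnInt p α β P ^ (1 / p) := by
  unfold wNorm mnInt
  rw [eLpNorm_eq_lintegral_rpow_enorm_toReal (by simpa using hp) ENNReal.ofReal_ne_top,
    ENNReal.toReal_ofReal hp.le, lintegral_withDensity_eq_lintegral_mul _ (mn_meas α β)]
  · rfl
  · have := (mn_cont P).measurable
    fun_prop

lemma mn_finite {p : ℝ} (hp : 0 < p) {α β : ℝ} (hα : 0 ≤ α) (hβ : -1 < β) (P : Polynomial ℂ) :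
    mnInt p α β P ≠ ∞ := by
  obtain ⟨B, hB⟩ := (isCompact_Icc (a := (-1:ℝ)) (b := 1)).exists_bound_of_continuousOn
    (mn_cont P).continuousOn
  have hint : IntegrableOn (fun t : ℝ => 1 + (1 - t) ^ β + (1 + t) ^ β) (Set.Icc (-1) 1) := by
    have h0 : IntervalIntegrable (fun x : ℝ => x ^ β) volume 0 2 :=
      intervalIntegral.intervalIntegrable_rpow' hβ
    have h1 := (h0.comp_sub_left 1)
    have h2 := (h0.comp_add_left 1)
    norm_num at h1 h2
    rw [← intervalIntegrable_iff_integrableOn_Icc_of_le (by norm_num)]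
    exact (intervalIntegrable_const.add h1.symm).add h2
  have hle : mnInt p α β P ≤ ∫⁻ t in Set.Icc (-1 : ℝ) 1,
      ENNReal.ofReal (1 + (1 - t) ^ β + (1 + t) ^ β) * (ENNReal.ofReal B) ^ p := by
    unfold mnInt
    have hae : ∀ᵐ t : ℝ ∂(volume.restrict (Set.Icc (-1 : ℝ) 1)), t ∈ Set.Ioo (-1 : ℝ) 1 := by
      rw [← restrict_Ioo_eq_restrict_Icc]
      exact ae_restrict_mem measurableSet_Ioo
    refine lintegral_mono_ae ?_
    filter_upwards [hae] with t ht
    have h1 : 0 < 1 - t := by linarith [ht.2]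
    have h2 : 0 < 1 + t := by linarith [ht.1]
    have h3 : 0 < 1 - t ^ 2 := by nlinarith
    have hb1 : 0 < (1 - t) ^ β := Real.rpow_pos_of_pos h1 _
    have hb2 : 0 < (1 + t) ^ β := Real.rpow_pos_of_pos h2 _
    gcongr
    · have ha : |t| ^ α ≤ 1 := Real.rpow_le_one (abs_nonneg _) (abs_le.mpr ⟨ht.1.le, ht.2.le⟩) hα
      have hb : (1 - t ^ 2) ^ β ≤ 1 + (1 - t) ^ β + (1 + t) ^ β := by
        rcases le_total 0 β with hβ0 | hβ0
        · have := Real.rpow_le_one h3.le (by nlinarith) hβ0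
          linarith
        · rcases le_total 0 t with h | h
          · have := Real.rpow_le_rpow_of_nonpos h1 (show 1 - t ≤ 1 - t ^ 2 by nlinarith) hβ0
            linarith
          · have := Real.rpow_le_rpow_of_nonpos h2 (show 1 + t ≤ 1 - t ^ 2 by nlinarith) hβ0
            linarith
      have hc : 0 < (1 - t ^ 2) ^ β := Real.rpow_pos_of_pos h3 _
      calc |t| ^ α * (1 - t ^ 2) ^ β ≤ 1 * (1 - t ^ 2) ^ β := by gcongr
        _ ≤ _ := by linarith
    · rw [← ofReal_norm]
      exact ENNReal.ofReal_le_ofReal (hB t ⟨ht.1.le, ht.2.le⟩)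
  refine ne_top_of_le_ne_top ?_ hle
  rw [lintegral_mul_const' _ _ (ENNReal.rpow_ne_top_of_nonneg hp.le ENNReal.ofReal_ne_top)]
  refine ENNReal.mul_ne_top ?_ (ENNReal.rpow_ne_top_of_nonneg hp.le ENNReal.ofReal_ne_top)
  exact hint.lintegral_lt_top.ne

lemma mn_interval {δ θ₀ : ℝ} (hδ : 0 < δ) (hδ1 : δ ≤ 1) (h0 : 0 ≤ θ₀) (hpi : θ₀ ≤ Real.pi) :
    ∃ u v : ℝ, v - u = δ / 4 ∧ 0 ≤ u ∧ v ≤ Real.pi ∧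
      ∀ θ ∈ Set.Ioo u v, |θ - θ₀| ≤ δ ∧ δ / 4 ≤ |Real.pi / 2 - θ| := by
  have hpi3 := Real.pi_gt_three
  obtain ⟨c, hc0, hc1, hc2, hc3⟩ : ∃ c : ℝ, 0 ≤ c ∧ c + δ ≤ Real.pi ∧ θ₀ - δ ≤ c ∧ c ≤ θ₀ := by
    rcases le_total θ₀ (Real.pi / 2) with h | h
    · exact ⟨θ₀, by linarith, by linarith, by linarith, le_rfl⟩
    · exact ⟨θ₀ - δ, by linarith, by linarith, le_rfl, by linarith⟩
  rcases le_total (c + δ / 2) (Real.pi / 2) with h | h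
  · refine ⟨c, c + δ / 4, by ring, hc0, by linarith, fun θ hθ => ⟨?_, ?_⟩⟩
    · rw [abs_le]; constructor <;> linarith [hθ.1, hθ.2]
    · refine le_trans ?_ (le_abs_self _); linarith [hθ.1, hθ.2]
  · refine ⟨c + 3 * δ / 4, c + δ, by ring, by linarith, by linarith, fun θ hθ => ⟨?_, ?_⟩⟩
    · rw [abs_le]; constructor <;> linarith [hθ.1, hθ.2]
    · refine le_trans ?_ (neg_le_abs _); linarith [hθ.1, hθ.2]

lemma mn_cos_lower {θ : ℝ} (h0 : 0 ≤ θ) (hpi : θ ≤ Real.pi) :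
    2 / Real.pi * |Real.pi / 2 - θ| ≤ |Real.cos θ| := by
  rw [← Real.sin_pi_div_two_sub]
  have h : |Real.pi / 2 - θ| ≤ Real.pi / 2 := by rw [abs_le]; constructor <;> linarith
  refine (Real.mul_le_sin (abs_nonneg _) h).trans ?_
  rcases abs_choice (Real.pi / 2 - θ) with h | h <;> rw [h]
  · exact le_abs_self _
  · rw [Real.sin_neg]; exact neg_le_abs _

lemma mn_pointwise {p α β : ℝ} (hp : 0 < p) (hα : 0 ≤ α) {m : ℕ}
    (hm : 2 * β + 1 ≤ 2 * m * p) {s c x K d : ℝ} (hs : 0 < s) (hs1 : s ≤ 1)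
    (hK : 0 ≤ K) (hd : 0 ≤ d) (hdc : d ≤ |c|) (hx : 0 ≤ x) (hsc : 1 - c ^ 2 = s ^ 2)
    (hKx : K ≤ x * (s ^ 2) ^ m) :
    K ^ p * d ^ α ≤ s * (|c| ^ α * (1 - c ^ 2) ^ β * x ^ p) := by
  have h1 : K ^ p ≤ x ^ p * s ^ (2 * β + 1) := by
    calc K ^ p ≤ (x * (s ^ 2) ^ m) ^ p := Real.rpow_le_rpow hK hKx hp.le
      _ = x ^ p * s ^ (2 * m * p) := by
        rw [Real.mul_rpow hx (by positivity), ← pow_mul, ← Real.rpow_natCast s,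
          ← Real.rpow_mul hs.le]
        push_cast; rfl
      _ ≤ _ := by
        gcongr ?_ * ?_
        exact Real.rpow_le_rpow_of_exponent_ge hs hs1 hm
  have h2 : (1 - c ^ 2) ^ β * s = s ^ (2 * β + 1) := by
    rw [hsc, ← Real.rpow_natCast s 2, ← Real.rpow_mul hs.le, Real.rpow_add_one hs.ne']
    norm_num
  have h3 : d ^ α ≤ |c| ^ α := Real.rpow_le_rpow hd hdc hα
  calc K ^ p * d ^ α ≤ (x ^ p * s ^ (2 * β + 1)) * |c| ^ α := by gcongr
    _ = _ := by rw [← h2]; ring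

lemma mn_lower {p α β : ℝ} (hp : 0 < p) (hα : 0 ≤ α) {m : ℕ}
    (hm : 2 * β + 1 ≤ 2 * m * p) {N : ℕ} (hN : 1 ≤ N) (P : Polynomial ℂ)
    (hQ : (P * (1 - X ^ 2) ^ m).natDegree ≤ N) {δ : ℝ} (hδ : δ = 1 / (6 * N)) :
    ∃ M : ℝ, (∀ t : ℝ, |t| ≤ 1 → ‖(P * (1 - X ^ 2) ^ m).eval (t : ℂ)‖ ≤ M) ∧
      ENNReal.ofReal ((M / 2) ^ p * (δ / (2 * Real.pi)) ^ α * (δ / 4)) ≤ mnInt p α β P := by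
  have hN1 : (1:ℝ) ≤ N := by exact_mod_cast hN
  have hδ0 : 0 < δ := by rw [hδ]; positivity
  have hδ1 : δ ≤ 1 := by rw [hδ, div_le_one (by positivity)]; linarith
  obtain ⟨t₀, ht₀, hmax⟩ := (isCompact_Icc (a := (-1:ℝ)) (b := 1)).exists_isMaxOn
    ⟨0, by norm_num⟩ (mn_cont (P * (1 - X ^ 2) ^ m)).norm.continuousOn
  set Q := P * (1 - X ^ 2) ^ m with hQdef
  set M := ‖Q.eval (t₀ : ℂ)‖ with hMdef
  have hM : ∀ t : ℝ, |t| ≤ 1 → ‖Q.eval (t : ℂ)‖ ≤ M := fun t ht => hmax (abs_le.mp ht)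
  refine ⟨M, hM, ?_⟩
  have hM0 : 0 ≤ M := norm_nonneg _
  obtain ⟨u, v, huv, hu, hv, hI⟩ :=
    mn_interval hδ0 hδ1 (Real.arccos_nonneg t₀) (Real.arccos_le_pi t₀)
  have hcos : Real.cos (Real.arccos t₀) = t₀ := Real.cos_arccos ht₀.1 ht₀.2
  have hsub : Real.cos '' Set.Ioo u v ⊆ Set.Icc (-1) 1 := by
    rintro _ ⟨θ, _, rfl⟩
    exact Real.cos_mem_Icc θ
  have hlow : ∀ θ ∈ Set.Ioo u v, M / 2 ≤ ‖Q.eval (Real.cos θ : ℂ)‖ := by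
    intro θ hθ
    have h1 := mn_lipschitz hN hQ hM (Real.arccos t₀) θ
    rw [hcos] at h1
    have h2 : 3 * M * N * |θ - Real.arccos t₀| ≤ M / 2 := by
      calc _ ≤ 3 * M * N * δ := by gcongr; exact (hI θ hθ).1
        _ = M / 2 := by rw [hδ]; field_simp; ring
    have h3 := norm_sub_norm_le (Q.eval (t₀ : ℂ)) (Q.eval (Real.cos θ : ℂ))
    rw [norm_sub_rev] at h3
    linarith
  calc ENNReal.ofReal ((M / 2) ^ p * (δ / (2 * Real.pi)) ^ α * (δ / 4))
      = ∫⁻ _ in Set.Ioo u v, ENNReal.ofReal ((M / 2) ^ p * (δ / (2 * Real.pi)) ^ α) := by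
        rw [setLIntegral_const, Real.volume_Ioo, huv, ENNReal.ofReal_mul (by positivity)]
    _ ≤ ∫⁻ θ in Set.Ioo u v, ENNReal.ofReal |-Real.sin θ| *
          (ENNReal.ofReal (|Real.cos θ| ^ α * (1 - Real.cos θ ^ 2) ^ β) *
            ‖P.eval ((Real.cos θ : ℝ) : ℂ)‖ₑ ^ p) := by
        refine setLIntegral_mono' measurableSet_Ioo fun θ hθ => ?_
        have hθ0 : 0 < θ := lt_of_le_of_lt hu hθ.1
        have hθ1 : θ < Real.pi := lt_of_lt_of_le hθ.2 hv
        have hs := Real.sin_pos_of_pos_of_lt_pi hθ0 hθ1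
        have hsc : 1 - Real.cos θ ^ 2 = Real.sin θ ^ 2 := by
          rw [Real.sin_sq]
        rw [← ofReal_norm, ENNReal.ofReal_rpow_of_nonneg (norm_nonneg _) hp.le,
          ← ENNReal.ofReal_mul (by rw [hsc]; positivity), ← ENNReal.ofReal_mul (abs_nonneg _),
          abs_neg, abs_of_pos hs]
        refine ENNReal.ofReal_le_ofReal (mn_pointwise hp hα hm hs (Real.sin_le_one θ) (by positivity)
          (by positivity) ?_ (norm_nonneg _) hsc ?_)
        · refine le_trans ?_ (mn_cos_lower hθ0.le hθ1.le)
          calc δ / (2 * Real.pi) = 2 / Real.pi * (δ / 4) := by field_simp; norm_num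
            _ ≤ _ := by gcongr; exact (hI θ hθ).2
        · refine (hlow θ hθ).trans (le_of_eq ?_)
          rw [hQdef, Polynomial.eval_mul, norm_mul]
          congr 1
          simp only [eval_pow, eval_sub, eval_one, eval_X, norm_pow]
          rw [← Complex.ofReal_pow, ← Complex.ofReal_one, ← Complex.ofReal_sub, hsc,
            Complex.norm_real, Real.norm_of_nonneg (sq_nonneg _)]
    _ = ∫⁻ t in Real.cos '' Set.Ioo u v,
          ENNReal.ofReal (|t| ^ α * (1 - t ^ 2) ^ β) * ‖P.eval (t : ℂ)‖ₑ ^ p := by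
        rw [lintegral_image_eq_lintegral_abs_deriv_mul measurableSet_Ioo
          (fun θ _ => (Real.hasDerivAt_cos θ).hasDerivWithinAt)
          (Real.injOn_cos.mono (Set.Ioo_subset_Icc_self.trans (Set.Icc_subset_Icc hu hv)))]
    _ ≤ mnInt p α β P := lintegral_mono_set hsub

lemma mn_sup {p α β : ℝ} (hp : 0 < p) (hα : 0 ≤ α) (hβ : -1 < β) {ε : ℝ} (hε0 : 0 < ε)
    (hε1 : ε < 1) :
    ∃ C : ℝ, 0 ≤ C ∧ ∀ n : ℕ, 1 ≤ n → ∀ P : Polynomial ℂ, P.natDegree ≤ n →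
      ∀ t : ℝ, |t| ≤ 1 - ε →
        ‖P.eval (t : ℂ)‖ ≤ C * (n : ℝ) ^ ((α + 1) / p) *
          (wNorm (ENNReal.ofReal p) α β (fun t : ℝ => P.eval (t : ℂ))).toReal := by
  obtain ⟨m, hm⟩ := exists_nat_ge ((2 * β + 1) / (2 * p))
  have hm' : 2 * β + 1 ≤ 2 * m * p := by
    rw [div_le_iff₀ (by positivity)] at hm; linarith
  set κ : ℝ := 1 / (6 * (2 * m + 1)) with hκ
  have hκ0 : 0 < κ := by positivity
  set c : ℝ := (κ / (2 * Real.pi)) ^ α * (κ / 4) with hc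
  have hc0 : 0 < c := by positivity
  set b : ℝ := (ε ^ m) with hb
  have hb0 : 0 < b := by positivity
  refine ⟨b⁻¹ * (2 * (c⁻¹) ^ (1 / p)), by positivity, fun n hn P hP t ht => ?_⟩
  have hn0 : (0:ℝ) < n := by exact_mod_cast hn
  have hQ : (P * (1 - X ^ 2) ^ m).natDegree ≤ (2 * m + 1) * n := by
    have h1 : ((1 : Polynomial ℂ) - X ^ 2).natDegree ≤ 2 := by
      refine (natDegree_sub_le _ _).trans ?_
      simp
    have h2 : ((1 - X ^ 2 : Polynomial ℂ) ^ m).natDegree ≤ m * 2 :=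
      natDegree_pow_le.trans (Nat.mul_le_mul_left _ h1)
    refine natDegree_mul_le.trans ?_
    nlinarith
  obtain ⟨M, hM, hI⟩ := mn_lower hp hα hm' (N := (2 * m + 1) * n) (by nlinarith) P hQ
    (δ := κ / n) (by rw [hκ]; push_cast; field_simp)
  have hM0 : 0 ≤ M := (norm_nonneg _).trans (hM 0 (by simp))
  rw [mn_wNorm hp, ← ENNReal.toReal_rpow]
  have hfin := mn_finite hp hα hβ P
  set I := (mnInt p α β P).toReal with hIdef
  have hI0 : 0 ≤ I := ENNReal.toReal_nonneg
  have hI' := (ENNReal.ofReal_le_iff_le_toReal hfin).mp hI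
  have hcn : (κ / n / (2 * Real.pi)) ^ α * (κ / n / 4) = c * ((n : ℝ) ^ (α + 1))⁻¹ := by
    rw [hc, div_right_comm, Real.div_rpow (by positivity) hn0.le, Real.rpow_add_one hn0.ne']
    field_simp
  have h1 : (M / 2) ^ p ≤ c⁻¹ * (n : ℝ) ^ (α + 1) * I := by
    rw [mul_assoc, hcn] at hI'
    have hnα : 0 < (n : ℝ) ^ (α + 1) := by positivity
    calc (M / 2) ^ p = c⁻¹ * (n : ℝ) ^ (α + 1) * ((M / 2) ^ p * (c * ((n : ℝ) ^ (α + 1))⁻¹)) := by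
          field_simp
      _ ≤ _ := by gcongr
  have h2 : M / 2 ≤ (c⁻¹) ^ (1 / p) * (n : ℝ) ^ ((α + 1) / p) * I ^ (1 / p) := by
    have := Real.rpow_le_rpow (by positivity) h1 (show 0 ≤ 1 / p by positivity)
    rw [← Real.rpow_mul (by positivity), mul_one_div_cancel hp.ne', Real.rpow_one,
      Real.mul_rpow (by positivity) hI0, Real.mul_rpow (by positivity) (by positivity),
      ← Real.rpow_mul hn0.le, mul_one_div] at this
    exact this
  have h3 : ‖P.eval (t : ℂ)‖ * b ≤ M := by
    refine le_trans ?_ (hM t (by linarith))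
    rw [Polynomial.eval_mul, norm_mul]
    gcongr
    simp only [eval_pow, eval_sub, eval_one, eval_X, norm_pow]
    rw [← Complex.ofReal_pow, ← Complex.ofReal_one, ← Complex.ofReal_sub,
            Complex.norm_real]
    rw [hb]
    gcongr
    refine le_trans ?_ (le_abs_self _)
    rw [← sq_abs]
    nlinarith [abs_nonneg t]
  have h4 : ‖P.eval (t : ℂ)‖ ≤ b⁻¹ * M := by
    rw [← div_eq_inv_mul, le_div_iff₀ hb0]; exact h3
  refine h4.trans ?_
  calc b⁻¹ * M = b⁻¹ * (2 * (M / 2)) := by ring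
    _ ≤ b⁻¹ * (2 * ((c⁻¹) ^ (1 / p) * (n : ℝ) ^ ((α + 1) / p) * I ^ (1 / p))) := by gcongr
    _ = _ := by ring

/-- **Lemma 5.4.**  For `ε ∈ (0,1/2)`, `p ∈ (0,∞)`, `α ≥ 0` and `β > -1` there is a
constant `C(α,β,p,ε)` such that for every `n ≥ 1`, every polynomial `P` of degree at
most `n`, and every `k ≥ 0`:
(i) `‖P‖_{L_∞([-1+ε,1-ε])} ≤ C n^{(α+1)/p} ‖P‖_{L_{p,|t|^α(1-t²)^β}([-1,1])}` and
(ii) `|P^{(k)}(0)| ≤ C (1-ε)^{-k} n^{k+(α+1)/p} ‖P‖_{L_{p,|t|^α(1-t²)^β}([-1,1])}`. -/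
theorem markov_nikolskii_weighted
    {ε : ℝ} (hε : ε ∈ Set.Ioo (0 : ℝ) (1/2)) {p : ℝ} (hp : 0 < p)
    {α : ℝ} (hα : 0 ≤ α) {β : ℝ} (hβ : -1 < β) :
    ∃ C : ℝ, ∀ n : ℕ, 1 ≤ n → ∀ P : Polynomial ℂ, P.natDegree ≤ n → ∀ k : ℕ,
      (∀ t : ℝ, |t| ≤ 1 - ε →
        ‖P.eval (t : ℂ)‖ ≤ C * (n : ℝ) ^ ((α + 1) / p) *
          (wNorm (ENNReal.ofReal p) α β (fun t : ℝ => P.eval (t : ℂ))).toReal) ∧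
      ‖(derivative^[k] P).eval (0 : ℂ)‖
        ≤ C * ((1 - ε) ^ k)⁻¹ * (n : ℝ) ^ ((k : ℝ) + (α + 1) / p) *
          (wNorm (ENNReal.ofReal p) α β (fun t : ℝ => P.eval (t : ℂ))).toReal := by
  obtain ⟨hε0, hε1⟩ := hε
  obtain ⟨C₁, hC₁, h₁⟩ := mn_sup hp hα hβ hε0 (by linarith)
  obtain ⟨C₂, hC₂, h₂⟩ := mn_sup hp hα hβ (half_pos hε0) (by linarith)
  set a : ℝ := 1 - ε with ha
  set a' : ℝ := 1 - ε / 2 with ha'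
  have ha0 : 0 < a := by linarith
  have ha'0 : 0 < a' := by linarith
  set q : ℝ := a' / a - 1 with hq
  have hq0 : 0 < q := by
    have : 1 < a' / a := by rw [one_lt_div ha0]; linarith
    linarith
  set D : ℝ := Real.exp 1 * q⁻¹ * C₂ with hD
  have hD0 : 0 ≤ D := by positivity
  refine ⟨C₁ + D, fun n hn P hP k => ?_⟩
  have hn0 : (0:ℝ) < n := by exact_mod_cast hn
  have h1 := h₁ n hn P hP
  have h2 := h₂ n hn P hP
  set W := (wNorm (ENNReal.ofReal p) α β (fun t : ℝ => P.eval (t : ℂ))).toReal with hW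
  have hW0 : 0 ≤ W := ENNReal.toReal_nonneg
  refine ⟨fun t ht => (h1 t ht).trans ?_, ?_⟩
  · gcongr; linarith
  · rcases Nat.eq_zero_or_pos k with rfl | hk
    · have := h1 0 (by simpa using ha0.le)
      simp only [Function.iterate_zero, id, pow_zero, inv_one, mul_one, Nat.cast_zero, zero_add]
      rw [Complex.ofReal_zero] at this
      refine this.trans ?_
      gcongr; linarith
    · have h3 := mn_deriv_zero hn hP ha'0 h2 k hk
      refine h3.trans ?_
      have hk2 : (k : ℝ) ≤ q⁻¹ * (a' / a) ^ k := by
        have hb := one_add_mul_le_pow (show (-2 : ℝ) ≤ q by linarith) k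
        rw [show 1 + q = a' / a by rw [hq]; ring] at hb
        rw [inv_mul_eq_div, le_div_iff₀ hq0]; linarith
      have e : (a' / a) ^ k * (n / a') ^ k = (a ^ k)⁻¹ * (n : ℝ) ^ k := by
        rw [← mul_pow, ← inv_pow, ← mul_pow]; congr 1; field_simp
      rw [Real.rpow_add hn0, Real.rpow_natCast]
      calc Real.exp 1 * k * (n / a') ^ k * (C₂ * (n : ℝ) ^ ((α + 1) / p) * W)
          ≤ Real.exp 1 * (q⁻¹ * (a' / a) ^ k) * (n / a') ^ k
              * (C₂ * (n : ℝ) ^ ((α + 1) / p) * W) := by gcongr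
        _ = D * ((a' / a) ^ k * (n / a') ^ k) * (n : ℝ) ^ ((α + 1) / p) * W := by rw [hD]; ring
        _ = D * (a ^ k)⁻¹ * ((n : ℝ) ^ k * (n : ℝ) ^ ((α + 1) / p)) * W := by rw [e]; ring
        _ ≤ _ := by gcongr; linarith
end
end

section
/- Let n ≥ 0, let R be a univariate polynomial with complex coefficients of degree at most n, let b be a nonzero real number, let ν ≥ −1/2, and let N ≥ 0 be an integer. Define the even polynomial P(t) := R(1 − 2b^{−2}t²). Then for all t ≠ 0, (Ge_{ν+1/2})^N(R)(1 − 2b^{−2}t²) = (D_{ν,b})^N(P)(t), where D_{ν,b}(g)(t) := (b²/4)·[(1 − t²/b²)·g''(t) + ((2ν+1) − ((4ν+3)/b²)·t²)·g'(t)/t], and for an even polynomial g the quotient g'(t)/t is again a polynomial, so that D_{ν,b}(g) is an even polynomial and (D_{ν,b})^N its N-th iterate. -/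
open Polynomial

noncomputable section

/-- The Gegenbauer operator `Ge_λ(φ)(t) = (1-t²)φ''(t) - (2λ+1)tφ'(t)` on polynomials. -/
def gegenOp (l : ℝ) (Q : Polynomial ℂ) : Polynomial ℂ :=
  (1 - X ^ 2) * derivative (derivative Q) - C ((2 * l + 1 : ℝ) : ℂ) * X * derivative Q

/-- The operator
`D_{ν,b}(g)(t) = (b²/4)[(1-t²/b²)g''(t) + ((2ν+1) - ((4ν+3)/b²)t²) g'(t)/t]`
on (even) polynomials; for an even polynomial `g` the quotient `g'(t)/t` is the
polynomial `(derivative g).divX`. -/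
def DOp (ν b : ℝ) (g : Polynomial ℂ) : Polynomial ℂ :=
  C ((b ^ 2 / 4 : ℝ) : ℂ) *
    ((1 - C (((b ^ 2)⁻¹ : ℝ) : ℂ) * X ^ 2) * derivative (derivative g) +
      (C ((2 * ν + 1 : ℝ) : ℂ) - C (((4 * ν + 3) / b ^ 2 : ℝ) : ℂ) * X ^ 2) *
        (derivative g).divX)

lemma DOp_comp_aux {b : ℝ} (hb : b ≠ 0) (ν : ℝ) (Q : Polynomial ℂ) :
    DOp ν b (Q.comp (1 - C ((2 / b ^ 2 : ℝ) : ℂ) * X ^ 2))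
      = (gegenOp (ν + 1/2) Q).comp (1 - C ((2 / b ^ 2 : ℝ) : ℂ) * X ^ 2) := by
  have hb' : (b : ℂ) ≠ 0 := by exact_mod_cast hb
  set c : ℂ := ((2 / b ^ 2 : ℝ) : ℂ) with hc
  have hs : derivative (1 - C c * X ^ 2 : Polynomial ℂ) = C (-2 * c) * X := by
    have h2 : (C 2 : Polynomial ℂ) = 2 := rfl
    simp [h2]
    ring
  have h1 : ∀ S : Polynomial ℂ, derivative (S.comp (1 - C c * X ^ 2))
      = C (-2 * c) * X * (derivative S).comp (1 - C c * X ^ 2) := by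
    intro S
    rw [derivative_comp, hs]
  have h2 : (derivative (Q.comp (1 - C c * X ^ 2))).divX
      = C (-2 * c) * (derivative Q).comp (1 - C c * X ^ 2) := by
    rw [h1, show C (-2 * c) * X * (derivative Q).comp (1 - C c * X ^ 2)
      = X * (C (-2 * c) * (derivative Q).comp (1 - C c * X ^ 2)) by ring]
    ext k
    rw [coeff_divX, coeff_X_mul]
  unfold DOp gegenOp
  rw [h2, h1, derivative_mul, h1]
  apply Polynomial.funext
  intro t
  simp only [derivative_mul, derivative_C, derivative_X, eval_mul, eval_add, eval_sub, eval_C,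
    eval_X, eval_pow, eval_one, eval_comp, eval_zero]
  generalize eval (1 - c * t ^ 2) (derivative (derivative Q)) = A
  generalize eval (1 - c * t ^ 2) (derivative Q) = B
  rw [hc]
  push_cast
  field_simp
  ring

/-- **Lemma 5.5 (b).**  Let `R` be a polynomial of degree at most `n`, `b ≠ 0`,
`ν ≥ -1/2` and `N ≥ 0`, and let `P(t) = R(1 - 2b⁻²t²)`.  Then for all `t ≠ 0`,
`(Ge_{ν+1/2})^N(R)(1 - 2b⁻²t²) = (D_{ν,b})^N(P)(t)`. -/
theorem gegenbauer_substitution (n : ℕ) (R : Polynomial ℂ) (hR : R.natDegree ≤ n)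
    {b : ℝ} (hb : b ≠ 0) {ν : ℝ} (hν : -(1/2 : ℝ) ≤ ν) (N : ℕ) :
    ∀ t : ℂ, t ≠ 0 →
      ((gegenOp (ν + 1/2))^[N] R).eval (1 - ((2 / b ^ 2 : ℝ) : ℂ) * t ^ 2)
        = ((DOp ν b)^[N] (R.comp (1 - C ((2 / b ^ 2 : ℝ) : ℂ) * X ^ 2))).eval t := by
  intro t _
  have key : ∀ (N : ℕ) (Q : Polynomial ℂ),
      (DOp ν b)^[N] (Q.comp (1 - C ((2 / b ^ 2 : ℝ) : ℂ) * X ^ 2))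
        = ((gegenOp (ν + 1/2))^[N] Q).comp (1 - C ((2 / b ^ 2 : ℝ) : ℂ) * X ^ 2) := by
    intro N
    induction N with
    | zero => intro Q; rfl
    | succ k ih =>
      intro Q
      rw [Function.iterate_succ_apply, Function.iterate_succ_apply, DOp_comp_aux hb, ih]
  rw [key, eval_comp]
  simp only [eval_sub, eval_one, eval_mul, eval_C, eval_pow, eval_X]
end
end
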